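/- Let k ≥ 1, let t be a k-fair trace and let p ∈ P be a process with |view_p(t)| ≥ k − 1. Then for every index i < f(view_p(t), k−1), Foata(t)_i = Foata(view_p(t))_i. -/

import Mathlib

variable {α P : Type*}

/-- One swap of two adjacent independent letters. -/
def SwapAdj [DecidableEq P] (loc : α → Finset P) (w w' : List α) : Prop :=
  ∃ (u v : List α) (a b : α), loc a ∩ loc b = ∅ ∧
    w = u ++ a :: b :: v ∧ w' = u ++ b :: a :: v

/-- Trace equivalence: finitely many swaps of adjacent independent letters. -/
def TraceEquiv [DecidableEq P] (loc : α → Finset P) : List α → List α → Prop :=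
  Relation.ReflTransGen (SwapAdj loc)

/-- The set of processes participating in a word. -/
def locWord [DecidableEq P] (loc : α → Finset P) (w : List α) : Finset P :=
  w.foldr (fun a s => loc a ∪ s) ∅

/-- The trace of `w` is `k`-fair: every factor of length at least `k` of every
linearisation involves all processes. -/
def IsFairTrace [DecidableEq P] [Fintype P] (loc : α → Finset P) (k : ℕ)
    (w : List α) : Prop :=
  ∀ w' u v x, TraceEquiv loc w w' → w' = u ++ v ++ x → k ≤ v.length →
    locWord loc v = Finset.univ

/-- Helper (on the reversed word) computing the view of a set of processes:
scanning from the right, keep an event iff its location meets the set of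
processes already known to be causally after it. -/
def viewRev [DecidableEq P] (loc : α → Finset P) : Finset P → List α → List α
  | _, [] => []
  | T, a :: w =>
    if (loc a ∩ T).Nonempty then a :: viewRev loc (T ∪ loc a) w
    else viewRev loc T w

/-- The view of a set `X` of processes in the trace of `w`, as a linearisation. -/
def viewWord [DecidableEq P] (loc : α → Finset P) (X : Finset P) (w : List α) : List α :=
  (viewRev loc X w.reverse).reverse

/-- Insertion of a letter in a (reversed) Foata normal form:
the letter is placed in the step just after the last step containing a letter
dependent on it (in a fresh last step, resp. the first step, if this is the
last step, resp. if there is no such step). -/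
def foataInsRev [DecidableEq α] [DecidableEq P] (loc : α → Finset P)
    (φ : List (Finset α)) (a : α) : List (Finset α) :=
  match φ.findIdx? (fun S => decide (∃ b ∈ S, (loc a ∩ loc b).Nonempty)) with
  | some 0 => {a} :: φ
  | some (i + 1) => φ.set i (insert a (φ.getD i ∅))
  | none =>
      if φ.isEmpty then [{a}]
      else φ.set (φ.length - 1) (insert a (φ.getD (φ.length - 1) ∅))

/-- The Foata normal form of (the trace of) a word, as its list of steps;
`(foata loc w).getD i ∅` is the `i`-th step (0-based, `∅` beyond the length). -/
def foata [DecidableEq α] [DecidableEq P] (loc : α → Finset P) (w : List α) :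
    List (Finset α) :=
  (w.foldl (foataInsRev loc) []).reverse

/-- `foataIdx loc w ℓ` is the largest (0-based) index `i` such that the steps of the
Foata normal form of `w` from index `i` on contain at least `ℓ` letters in total.
(0-based: it equals the paper's 1-based `f(t, ℓ)` minus one.) -/
noncomputable def foataIdx [DecidableEq α] [DecidableEq P] (loc : α → Finset P)
    (w : List α) (ℓ : ℕ) : ℕ :=
  sSup {i : ℕ | ℓ ≤ (((foata loc w).drop i).map Finset.card).sum}

theorem te_append [DecidableEq P] (loc : α → Finset P) {w w' : List α}
    (h : TraceEquiv loc w w') (x y : List α) :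
    TraceEquiv loc (x ++ w ++ y) (x ++ w' ++ y) := by
  induction h with
  | refl => exact Relation.ReflTransGen.refl
  | tail _ h2 ih =>
    refine Relation.ReflTransGen.tail ih ?_
    obtain ⟨u, v, a, b, hab, rfl, rfl⟩ := h2
    exact ⟨x ++ u, v ++ y, a, b, hab, by simp, by simp⟩

theorem te_move [DecidableEq P] (loc : α → Finset P) (a : α) (B : List α)
    (hB : ∀ b ∈ B, loc b ∩ loc a = ∅) :
    TraceEquiv loc (B ++ [a]) (a :: B) := by
  induction B with
  | nil => exact Relation.ReflTransGen.refl
  | cons b B ih =>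
    have h1 := te_append loc (ih (fun c hc => hB c (by simp [hc]))) [b] []
    simp only [List.append_nil, List.singleton_append] at h1
    refine Relation.ReflTransGen.tail (b := b :: a :: B) h1 ?_
    exact ⟨[], B, b, a, hB b (by simp), rfl, rfl⟩

theorem view_split [DecidableEq P] (loc : α → Finset P) (r : List α) :
    ∀ T : Finset P, ∃ rest, TraceEquiv loc r.reverse ((viewRev loc T r).reverse ++ rest) ∧
      ∀ b ∈ rest, loc b ∩ T = ∅ := by
  induction r with
  | nil => intro T; exact ⟨[], Relation.ReflTransGen.refl, by simp⟩
  | cons a r ih =>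
    intro T
    by_cases h : (loc a ∩ T).Nonempty
    · obtain ⟨rest, h1, h2⟩ := ih (T ∪ loc a)
      refine ⟨rest, ?_, ?_⟩
      · have h3 := te_append loc h1 [] [a]
        have h4 := te_append loc (te_move loc a rest (fun b hb => by
          have := h2 b hb
          rw [Finset.inter_union_distrib_left, Finset.union_eq_empty] at this
          exact this.2)) (viewRev loc (T ∪ loc a) r).reverse []
        simp only [viewRev, if_pos h]
        simp only [List.append_nil, List.nil_append, List.append_assoc] at h3 h4
        have h5 : TraceEquiv loc _ _ := Relation.ReflTransGen.trans h3 h4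
        simpa using h5
      · intro b hb
        have := h2 b hb
        rw [Finset.inter_union_distrib_left, Finset.union_eq_empty] at this
        exact this.1
    · obtain ⟨rest, h1, h2⟩ := ih T
      refine ⟨rest ++ [a], ?_, ?_⟩
      · have h3 := te_append loc h1 [] [a]
        simp only [viewRev, if_neg h]
        simpa using h3
      · intro b hb
        rcases List.mem_append.1 hb with hb | hb
        · exact h2 b hb
        · rw [List.mem_singleton] at hb
          subst hb
          exact Finset.not_nonempty_iff_eq_empty.1 h

/-- The letter `a` depends on some letter of `S`. -/
def DepOn [DecidableEq P] (loc : α → Finset P) (a : α) (S : Finset α) : Prop :=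
  ∃ b ∈ S, (loc a ∩ loc b).Nonempty

/-- The steps of a reversed normal form, as a function. -/
def stepFn (φ : List (Finset α)) (m : ℕ) : Finset α := φ.reverse.getD m ∅

/-- `q` is the insertion position for `a`. -/
def IsPos [DecidableEq P] (loc : α → Finset P) (f : ℕ → Finset α) (a : α) (q : ℕ) : Prop :=
  (∀ m, q ≤ m → ¬ DepOn loc a (f m)) ∧ (∀ m, q = m + 1 → DepOn loc a (f m))

theorem IsPos.unique [DecidableEq P] {loc : α → Finset P} {f : ℕ → Finset α} {a : α} {q r : ℕ}
    (h : IsPos loc f a q) (h' : IsPos loc f a r) : q = r := by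
  rcases lt_trichotomy q r with hlt | h0 | hlt
  · obtain ⟨m, rfl⟩ : ∃ m, r = m + 1 := ⟨r - 1, by omega⟩
    exact absurd (h'.2 m rfl) (h.1 m (by omega))
  · exact h0
  · obtain ⟨m, rfl⟩ : ∃ m, q = m + 1 := ⟨q - 1, by omega⟩
    exact absurd (h.2 m rfl) (h'.1 m (by omega))

theorem stepFn_eq (φ : List (Finset α)) (m : ℕ) :
    stepFn φ m = if m < φ.length then φ.getD (φ.length - 1 - m) ∅ else ∅ := by
  unfold stepFn
  split_ifs with h
  · rw [List.getD_eq_getElem _ _ (by simpa using h), List.getD_eq_getElem _ _ (by omega),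
      List.getElem_reverse]
  · rw [List.getD_eq_default]
    simpa using h

theorem stepFn_ins [DecidableEq α] [DecidableEq P] (loc : α → Finset P)
    (φ : List (Finset α)) (a : α) :
    ∃ q, IsPos loc (stepFn φ) a q ∧
      stepFn (foataInsRev loc φ a) = Function.update (stepFn φ) q (insert a (stepFn φ q)) := by
  have hset : ∀ i, i < φ.length →
      stepFn (φ.set i (insert a (φ.getD i ∅))) =
        Function.update (stepFn φ) (φ.length - 1 - i)
          (insert a (stepFn φ (φ.length - 1 - i))) := by
    intro i hi
    funext m
    rw [Function.update_apply, stepFn_eq, stepFn_eq, stepFn_eq]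
    rw [List.length_set, if_pos (show φ.length - 1 - i < φ.length by omega)]
    have e : φ.length - 1 - (φ.length - 1 - i) = i := by omega
    rw [e]
    by_cases hm : m < φ.length
    · rw [if_pos hm, if_pos hm]
      rw [List.getD_eq_getElem _ _ (by simp; omega), List.getElem_set]
      by_cases hmi : i = φ.length - 1 - m
      · rw [if_pos hmi, if_pos (by omega)]
      · rw [if_neg hmi, if_neg (by omega)]
        exact (List.getD_eq_getElem _ _ (by omega)).symm
    · rw [if_neg hm, if_neg hm, if_neg (by omega)]
  have hemp : ¬ DepOn loc a ∅ := by simp [DepOn]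
  unfold foataInsRev
  split
  · rename_i h
    rw [List.findIdx?_eq_some_iff_getElem] at h
    obtain ⟨h0, h1, -⟩ := h
    refine ⟨φ.length, ⟨?_, ?_⟩, ?_⟩
    · intro m hm
      rw [stepFn_eq, if_neg (by omega)]
      exact hemp
    · intro m hm
      rw [stepFn_eq, if_pos (by omega), show φ.length - 1 - m = 0 by omega,
        List.getD_eq_getElem _ _ h0]
      rw [decide_eq_true_eq] at h1
      exact h1
    · funext m
      rw [Function.update_apply, stepFn_eq φ φ.length, if_neg (lt_irrefl _)]
      unfold stepFn
      rw [List.reverse_cons]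
      rcases lt_trichotomy m φ.length with hm | hm | hm
      · rw [List.getD_append _ _ _ _ (by simpa using hm), if_neg (by omega)]
      · subst hm
        rw [List.getD_append_right _ _ _ _ (by simp)]
        simp
      · rw [if_neg (by omega), List.getD_eq_default _ _ (by simp; omega),
          List.getD_eq_default _ _ (by simp; omega)]
  · rename_i i h
    rw [List.findIdx?_eq_some_iff_getElem] at h
    obtain ⟨h0, h1, h2⟩ := h
    refine ⟨φ.length - 1 - i, ⟨?_, ?_⟩, hset i (by omega)⟩
    · intro m hm
      rw [stepFn_eq]
      split_ifs with hl
      · rw [List.getD_eq_getElem _ _ (by omega)]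
        have := h2 (φ.length - 1 - m) (by omega)
        rw [decide_eq_true_eq] at this
        exact this
      · exact hemp
    · intro m hm
      rw [stepFn_eq, if_pos (by omega), show φ.length - 1 - m = i + 1 by omega,
        List.getD_eq_getElem _ _ h0]
      rw [decide_eq_true_eq] at h1
      exact h1
  · rename_i h
    rw [List.findIdx?_eq_none_iff] at h
    refine ⟨0, ⟨?_, ?_⟩, ?_⟩
    · intro m _
      rw [stepFn_eq]
      split_ifs with hl
      · rw [List.getD_eq_getElem _ _ (by omega)]
        have := h _ (List.getElem_mem (show φ.length - 1 - m < φ.length by omega))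
        rw [decide_eq_false_iff_not] at this
        exact this
      · exact hemp
    · intro m hm
      omega
    · split_ifs with he
      · rw [List.isEmpty_iff] at he
        subst he
        funext m
        rw [Function.update_apply]
        cases m <;> simp [stepFn]
      · rw [List.isEmpty_iff] at he
        have := List.length_pos_iff.2 he
        have h3 := hset (φ.length - 1) (by omega)
        rwa [Nat.sub_self] at h3

theorem stepFn_ins_congr [DecidableEq α] [DecidableEq P] (loc : α → Finset P)
    {φ ψ : List (Finset α)} (h : stepFn φ = stepFn ψ) (a : α) :
    stepFn (foataInsRev loc φ a) = stepFn (foataInsRev loc ψ a) := by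
  obtain ⟨q, h1, h2⟩ := stepFn_ins loc φ a
  obtain ⟨r, h3, h4⟩ := stepFn_ins loc ψ a
  rw [h] at h1 h2
  rw [h2, h4, h1.unique h3]

theorem stepFn_foldl_congr [DecidableEq α] [DecidableEq P] (loc : α → Finset P) (w : List α) :
    ∀ {φ ψ : List (Finset α)}, stepFn φ = stepFn ψ →
    stepFn (w.foldl (foataInsRev loc) φ) = stepFn (w.foldl (foataInsRev loc) ψ) := by
  induction w with
  | nil => intro φ ψ h; exact h
  | cons a w ih => intro φ ψ h; exact ih (stepFn_ins_congr loc h a)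

theorem depOn_update [DecidableEq α] [DecidableEq P] {loc : α → Finset P} {a b : α}
    (hab : loc a ∩ loc b = ∅) (f : ℕ → Finset α) (q m : ℕ) :
    DepOn loc a (Function.update f q (insert b (f q)) m) ↔ DepOn loc a (f m) := by
  rw [Function.update_apply]
  split_ifs with h
  · subst h
    simp [DepOn, hab]
  · rfl

theorem stepFn_ins_comm [DecidableEq α] [DecidableEq P] (loc : α → Finset P)
    (φ : List (Finset α)) {a b : α} (hab : loc a ∩ loc b = ∅) :
    stepFn (foataInsRev loc (foataInsRev loc φ a) b) =
      stepFn (foataInsRev loc (foataInsRev loc φ b) a) := by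
  have hba : loc b ∩ loc a = ∅ := by rwa [Finset.inter_comm]
  obtain ⟨q, h1, h2⟩ := stepFn_ins loc φ a
  obtain ⟨r, h3, h4⟩ := stepFn_ins loc φ b
  obtain ⟨r', h5, h6⟩ := stepFn_ins loc (foataInsRev loc φ a) b
  obtain ⟨q', h7, h8⟩ := stepFn_ins loc (foataInsRev loc φ b) a
  have e1 : r' = r := by
    refine IsPos.unique (f := stepFn φ) ?_ h3
    rw [h2] at h5
    exact ⟨fun m hm => (depOn_update hba _ _ _).not.1 (h5.1 m hm),
      fun m hm => (depOn_update hba _ _ _).1 (h5.2 m hm)⟩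
  have e2 : q' = q := by
    refine IsPos.unique (f := stepFn φ) ?_ h1
    rw [h4] at h7
    exact ⟨fun m hm => (depOn_update hab _ _ _).not.1 (h7.1 m hm),
      fun m hm => (depOn_update hab _ _ _).1 (h7.2 m hm)⟩
  rw [h6, h8, h2, h4, e1, e2]
  funext m
  simp only [Function.update_apply]
  by_cases hm : m = r <;> by_cases hm' : m = q
  · subst hm; subst hm'; simp [Finset.insert_comm]
  · subst hm; simp [hm']
  · subst hm'; simp [hm]
  · simp [hm, hm']

theorem stepFn_te [DecidableEq α] [DecidableEq P] (loc : α → Finset P) {w w' : List α}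
    (h : TraceEquiv loc w w') :
    stepFn (w.foldl (foataInsRev loc) []) = stepFn (w'.foldl (foataInsRev loc) []) := by
  induction h with
  | refl => rfl
  | tail _ h2 ih =>
    rw [ih]
    obtain ⟨u, v, a, b, hab, rfl, rfl⟩ := h2
    simp only [List.foldl_append, List.foldl_cons]
    exact stepFn_foldl_congr loc v (stepFn_ins_comm loc _ hab)

theorem split_at [DecidableEq α] [DecidableEq P] (loc : α → Finset P) (i : ℕ) (v : List α) :
    ∃ A B, TraceEquiv loc v (A ++ B) ∧
      (∀ b ∈ B, ∃ m, i ≤ m ∧ b ∈ stepFn (v.foldl (foataInsRev loc) []) m) ∧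
      ∀ N, ∑ m ∈ Finset.Ico i N, (stepFn (v.foldl (foataInsRev loc) []) m).card ≤ B.length := by
  induction v using List.reverseRecOn with
  | nil => exact ⟨[], [], Relation.ReflTransGen.refl, by simp, by simp [stepFn]⟩
  | append_singleton v a ih =>
    obtain ⟨A, B, h1, h2, h3⟩ := ih
    rw [List.foldl_append, List.foldl_cons, List.foldl_nil]
    set φ := v.foldl (foataInsRev loc) []
    obtain ⟨q, hq, hf⟩ := stepFn_ins loc φ a
    rw [hf]
    have hsub : ∀ m, stepFn φ m ⊆ Function.update (stepFn φ) q (insert a (stepFn φ q)) m := by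
      intro m
      rw [Function.update_apply]
      split_ifs with h
      · subst h; exact Finset.subset_insert _ _
      · exact subset_rfl
    have h4 := te_append loc h1 [] [a]
    simp only [List.nil_append] at h4
    by_cases hqi : i ≤ q
    · refine ⟨A, B ++ [a], by simpa using h4, ?_, ?_⟩
      · intro b hb
        rcases List.mem_append.1 hb with hb | hb
        · obtain ⟨m, hm, hb⟩ := h2 b hb
          exact ⟨m, hm, hsub m hb⟩
        · rw [List.mem_singleton] at hb
          subst hb
          exact ⟨q, hqi, by simp⟩
      · intro N
        have : ∀ m ∈ Finset.Ico i N,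
            (Function.update (stepFn φ) q (insert a (stepFn φ q)) m).card ≤
              (stepFn φ m).card + if m = q then 1 else 0 := by
          intro m _
          rw [Function.update_apply]
          split_ifs with h
          · subst h; exact Finset.card_insert_le _ _
          · simp
        refine (Finset.sum_le_sum this).trans ?_
        rw [Finset.sum_add_distrib, Finset.sum_ite_eq', List.length_append]
        have := h3 N
        simp only [List.length_singleton]
        split_ifs <;> omega
    · refine ⟨A ++ [a], B, ?_, ?_, ?_⟩
      · have h5 := te_append loc (te_move loc a B (fun b hb => by
          obtain ⟨m, hm, hb⟩ := h2 b hb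
          have := hq.1 m (by omega)
          by_contra hne
          refine this ⟨b, hb, ?_⟩
          rw [Finset.inter_comm]
          exact Finset.nonempty_iff_ne_empty.2 hne)) A []
        simp only [List.append_nil, List.append_assoc] at h4 h5
        have h6 : TraceEquiv loc _ _ := Relation.ReflTransGen.trans h4 h5
        simpa using h6
      · intro b hb
        obtain ⟨m, hm, hb⟩ := h2 b hb
        exact ⟨m, hm, hsub m hb⟩
      · intro N
        refine le_trans (le_of_eq ?_) (h3 N)
        refine Finset.sum_congr rfl (fun m hm => ?_)
        rw [Finset.mem_Ico] at hm
        rw [Function.update_of_ne (by omega)]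

theorem step_nonempty [DecidableEq α] [DecidableEq P] (loc : α → Finset P) (v : List α) :
    ∀ m, (stepFn (v.foldl (foataInsRev loc) []) (m + 1)).Nonempty →
      (stepFn (v.foldl (foataInsRev loc) []) m).Nonempty := by
  induction v using List.reverseRecOn with
  | nil => intro m; simp [stepFn]
  | append_singleton v a ih =>
    intro m
    rw [List.foldl_append, List.foldl_cons, List.foldl_nil]
    obtain ⟨q, hq, hf⟩ := stepFn_ins loc (v.foldl (foataInsRev loc) []) a
    rw [hf]
    intro h
    by_cases h1 : m = q
    · subst h1; simp
    · rw [Function.update_of_ne h1]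
      by_cases h2 : m + 1 = q
      · obtain ⟨b, hb, -⟩ := hq.2 m h2.symm
        exact ⟨b, hb⟩
      · rw [Function.update_of_ne h2] at h
        exact ih m h

theorem step_nonempty_le [DecidableEq α] [DecidableEq P] (loc : α → Finset P) (v : List α)
    (i n : ℕ) (hin : i ≤ n) (h : (stepFn (v.foldl (foataInsRev loc) []) n).Nonempty) :
    (stepFn (v.foldl (foataInsRev loc) []) i).Nonempty := by
  induction n, hin using Nat.le_induction with
  | base => exact h
  | succ n _ ih => exact ih (step_nonempty loc v n h)

theorem sum_drop_eq (L : List (Finset α)) (i : ℕ) :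
    ((L.drop i).map Finset.card).sum = ∑ m ∈ Finset.Ico i L.length, (L.getD m ∅).card := by
  induction L generalizing i with
  | nil => simp
  | cons S L ih =>
    cases i with
    | zero =>
      have := ih 0
      simp only [List.drop_zero] at this
      rw [List.drop_zero, List.map_cons, List.sum_cons, this, List.length_cons,
        ← Finset.range_eq_Ico, ← Finset.range_eq_Ico, Finset.sum_range_succ']
      simp [add_comm]
    | succ i =>
      rw [List.drop_succ_cons, ih i, List.length_cons, ← Finset.sum_Ico_add']
      simp

theorem mem_locWord [DecidableEq P] (loc : α → Finset P) (v : List α) (x : P) :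
    x ∈ locWord loc v ↔ ∃ b ∈ v, x ∈ loc b := by
  induction v with
  | nil => simp [locWord]
  | cons a v ih =>
    have : locWord loc (a :: v) = loc a ∪ locWord loc v := rfl
    rw [this, Finset.mem_union, ih]
    simp

theorem rest_stable [DecidableEq α] [DecidableEq P] (loc : α → Finset P) (i : ℕ)
    (f : ℕ → Finset α) (hf : ∀ a, ∃ m, i ≤ m ∧ DepOn loc a (f m)) (rest : List α) :
    ∀ φ : List (Finset α), (∀ m, f m ⊆ stepFn φ m) →
      stepFn (rest.foldl (foataInsRev loc) φ) i = stepFn φ i := by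
  induction rest with
  | nil => intro φ _; rfl
  | cons a rest ih =>
    intro φ hφ
    obtain ⟨q, hq, hup⟩ := stepFn_ins loc φ a
    rw [List.foldl_cons, ih, hup]
    · obtain ⟨m, him, b, hb, hd⟩ := hf a
      have : m < q := by
        by_contra hle
        exact hq.1 m (by omega) ⟨b, hφ m hb, hd⟩
      rw [Function.update_of_ne (by omega)]
    · intro m
      rw [hup, Function.update_apply]
      split_ifs with h
      · subst h; exact (hφ _).trans (Finset.subset_insert _ _)
      · exact hφ m

/-- For a `k`-fair trace `t` and a process `p` whose view has
length at least `k - 1`, all Foata steps of index `< f(view_p(t), k-1)` of the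
view coincide with those of the full trace. (0-based indices.) -/
theorem foata_eq_on_view_of_fair [DecidableEq α] [DecidableEq P]
    [Fintype α] [Fintype P]
    (loc : α → Finset P) (hloc : ∀ a, (loc a).Nonempty)
    (k : ℕ) (hk : 1 ≤ k) (w : List α) (hfair : IsFairTrace loc k w)
    (p : P) (hlen : k - 1 ≤ (viewWord loc {p} w).length) :
    ∀ i < foataIdx loc (viewWord loc {p} w) (k - 1),
      (foata loc w).getD i ∅ = (foata loc (viewWord loc {p} w)).getD i ∅ := by
  intro i hi
  set v := viewWord loc {p} w with hv
  set S := {i : ℕ | k - 1 ≤ (((foata loc v).drop i).map Finset.card).sum} with hS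
  have hi' : i < sSup S := hi
  have hne : S.Nonempty := by
    by_contra h
    rw [Set.not_nonempty_iff_eq_empty] at h
    rw [h] at hi'
    simp at hi'
  have hbdd : BddAbove S := by
    by_contra h
    rw [Nat.sSup_of_not_bddAbove h] at hi'
    omega
  have hmem : sSup S ∈ S := Nat.sSup_mem hne hbdd
  have hk2 : 2 ≤ k := by
    by_contra hlt
    apply not_bddAbove_univ (α := ℕ)
    refine hbdd.mono (fun j _ => ?_)
    simp only [hS, Set.mem_ofPred_eq]
    omega
  set n := sSup S with hn
  have hmem' : k - 1 ≤ ∑ m ∈ Finset.Ico n (foata loc v).length,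
      (stepFn (v.foldl (foataInsRev loc) []) m).card := by
    have h := hmem
    simp only [hS, Set.mem_ofPred_eq] at h
    rw [sum_drop_eq] at h
    exact h
  set N := (foata loc v).length
  set f := stepFn (v.foldl (foataInsRev loc) []) with hf
  have hfi : 1 ≤ (f i).card := by
    obtain ⟨m, hm, hm0⟩ := Finset.exists_ne_zero_of_sum_ne_zero
      (show ∑ m ∈ Finset.Ico n N, (f m).card ≠ 0 by omega)
    rw [Finset.mem_Ico] at hm
    exact Finset.card_pos.2 (step_nonempty_le loc v i m (by omega)
      (Finset.card_pos.1 (Nat.pos_of_ne_zero hm0)))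
  have hnN : n < N := by
    by_contra h
    rw [Finset.Ico_eq_empty (by omega)] at hmem'
    simp at hmem'
    omega
  have hsum : k ≤ ∑ m ∈ Finset.Ico i N, (f m).card := by
    rw [Finset.sum_eq_sum_Ico_succ_bot (by omega)]
    have : ∑ m ∈ Finset.Ico n N, (f m).card ≤ ∑ m ∈ Finset.Ico (i + 1) N, (f m).card :=
      Finset.sum_le_sum_of_subset (Finset.Ico_subset_Ico (by omega) le_rfl)
    omega
  obtain ⟨A, B, h1, h2, h3⟩ := split_at loc i v
  obtain ⟨rest, h4, -⟩ := view_split loc w.reverse {p}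
  rw [List.reverse_reverse] at h4
  have h4' : TraceEquiv loc w (v ++ rest) := h4
  have h5 : TraceEquiv loc w (A ++ B ++ rest) :=
    Relation.ReflTransGen.trans h4' (te_append loc h1 [] rest)
  have h6 := hfair _ A B rest h5 rfl (hsum.trans (h3 N))
  have h7 : ∀ a, ∃ m, i ≤ m ∧ DepOn loc a (f m) := by
    intro a
    obtain ⟨x, hx⟩ := hloc a
    obtain ⟨b, hb, hxb⟩ := (mem_locWord loc B x).1 (by rw [h6]; exact Finset.mem_univ x)
    obtain ⟨m, hm, hbm⟩ := h2 b hb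
    exact ⟨m, hm, b, hbm, x, Finset.mem_inter.2 ⟨hx, hxb⟩⟩
  have h8 := rest_stable loc i f h7 rest _ (fun m => subset_rfl)
  rw [← List.foldl_append, ← stepFn_te loc h4'] at h8
  exact h8
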